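/- arXiv:2401.04826 — 7 statements merged into one kernel-verified Lean document; each statement's English description precedes it below -/
import Mathlib

section
/- Let G be a finite group and V a finite-dimensional real representation of G of odd dimension. Then d(V), the greatest common divisor of the indices (G : H) over all subgroups H ≤ G with V^H ≠ 0, is either 1 or 2 (equivalently, d(V) divides 2). -/
/- `drep G V` is the greatest common divisor of the indices `(G : H)` over all
subgroups `H ≤ G` such that the fixed subspace `V^H` is nonzero.
(Subgroups with `V^H = 0` contribute `0`, which does not affect the gcd.) -/
open Classical in
noncomputable def drep (G V : Type*) [Group G] [Fintype G] [AddCommGroup V]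
    [SMul G V] : ℕ :=
  letI : Fintype (Subgroup G) := Fintype.ofFinite _
  Finset.gcd Finset.univ fun H : Subgroup G =>
    if ∃ v : V, v ≠ 0 ∧ ∀ h ∈ H, h • v = v then H.index else 0

theorem Polynomial.exists_isRoot_of_odd_natDegree_of_monic {p : Polynomial ℝ}
    (hp : p.Monic) (hodd : Odd p.natDegree) : ∃ x, p.IsRoot x := by
  by_contra! h
  have hlc : 0 ≤ p.leadingCoeff := by simp [hp.leadingCoeff]
  have h₁ := p.zero_lt_eval_of_roots_lt_of_leadingCoeff_nonneg (x := 0)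
    (fun y hy => absurd hy (h y)) hlc
  have h₂ := p.zero_lt_negOnePow_mul_eval_of_lt_roots_of_leadingCoeff_nonneg (x := 0)
    (fun y hy => absurd hy (h y)) hlc
  rw [Int.negOnePow_odd _ (by exact_mod_cast hodd)] at h₂
  push_cast at h₂
  linarith

theorem Module.End.exists_hasEigenvalue_of_odd_finrank {V : Type*} [AddCommGroup V] [Module ℝ V]
    [FiniteDimensional ℝ V] (hodd : Odd (Module.finrank ℝ V)) (f : Module.End ℝ V) :
    ∃ μ : ℝ, f.HasEigenvalue μ := by
  obtain ⟨μ, hμ⟩ := Polynomial.exists_isRoot_of_odd_natDegree_of_monic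
    (LinearMap.charpoly_monic f) (by rwa [LinearMap.charpoly_natDegree])
  exact ⟨μ, (Module.End.hasEigenvalue_iff_isRoot_charpoly f μ).2 hμ⟩

theorem Module.End.exists_eq_or_eq_neg_of_pow_eq_one {V : Type*} [AddCommGroup V] [Module ℝ V]
    [FiniteDimensional ℝ V] (hodd : Odd (Module.finrank ℝ V)) {f : Module.End ℝ V} {n : ℕ}
    (hn : n ≠ 0) (hf : f ^ n = 1) : ∃ v : V, v ≠ 0 ∧ (f v = v ∨ f v = -v) := by
  obtain ⟨μ, hμ⟩ := exists_hasEigenvalue_of_odd_finrank hodd f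
  obtain ⟨v, hv⟩ := hμ.exists_hasEigenvector
  have h : μ ^ n = 1 := by
    have := hv.pow_apply n
    rw [hf, Module.End.one_apply] at this
    refine (smul_left_injective ℝ hv.2) ?_
    simpa using this.symm
  refine ⟨v, hv.2, ?_⟩
  rw [hv.apply_eq_smul]
  rcases (pow_eq_one_iff_of_ne_zero hn).1 h with rfl | ⟨rfl, -⟩ <;> simp

namespace Representation

open scoped commutatorElement

variable {G V : Type*} [Group G] [AddCommGroup V] [Module ℝ V]

theorem det_commutatorElement (ρ : Representation ℝ G V) (g h : G) :
    LinearMap.det (ρ ⁅g, h⁆) = 1 := by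
  let χ : G →* ℝ := LinearMap.det.comp ρ
  have : χ ⁅g, h⁆ = χ (g * g⁻¹) * χ (h * h⁻¹) := by
    simp only [commutatorElement_def, map_mul]
    ring
  simpa [χ] using this

variable [FiniteDimensional ℝ V]

/-- If every invariant subspace of odd dimension is everything, an endomorphism commuting with
the representation is zero or injective. -/
theorem eq_zero_or_injective_of_commute (ρ : Representation ℝ G V)
    (hodd : Odd (Module.finrank ℝ V))
    (hmin : ∀ W : Submodule ℝ V, (∀ g, W ≤ W.comap (ρ g)) → Odd (Module.finrank ℝ W) → W = ⊤)
    {f : Module.End ℝ V} (hf : ∀ g, Commute f (ρ g)) :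
    f = 0 ∨ Function.Injective f := by
  have hcomm (g : G) (v : V) : f (ρ g v) = ρ g (f v) := LinearMap.congr_fun (hf g) v
  have hsum := LinearMap.finrank_range_add_finrank_ker f
  rw [← hsum] at hodd
  rcases Nat.even_or_odd (Module.finrank ℝ (LinearMap.ker f)) with hk | hk
  · right
    have hr : LinearMap.range f = ⊤ := by
      refine hmin _ ?_ ?_
      · rintro g _ ⟨v, rfl⟩
        exact ⟨ρ g v, hcomm g v⟩
      · exact (Nat.odd_add.1 hodd).2 hk
    exact LinearMap.injective_iff_surjective.2 (LinearMap.range_eq_top.1 hr)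
  · left
    refine LinearMap.ker_eq_top.1 (hmin _ (fun g v hv => ?_) hk)
    simp_all [LinearMap.mem_ker]

theorem eq_one_or_eq_neg_one_of_commute [Finite G] (ρ : Representation ℝ G V)
    (hodd : Odd (Module.finrank ℝ V))
    (hmin : ∀ W : Submodule ℝ V, (∀ g, W ≤ W.comap (ρ g)) → Odd (Module.finrank ℝ W) → W = ⊤)
    {g : G} (hg : ∀ h, Commute (ρ g) (ρ h)) : ρ g = 1 ∨ ρ g = -1 := by
  obtain ⟨v, hv, h⟩ := Module.End.exists_eq_or_eq_neg_of_pow_eq_one hodd (f := ρ g)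
    (orderOf_pos g).ne' (by rw [← map_pow, pow_orderOf_eq_one, map_one])
  rcases h with h | h
  · left
    rcases ρ.eq_zero_or_injective_of_commute hodd hmin (f := ρ g - 1)
      (fun k => (hg k).sub_left (Commute.one_left _)) with h0 | hi
    · exact sub_eq_zero.1 h0
    · exact absurd (hi (by simp [h] : (ρ g - 1) v = (ρ g - 1) 0)) hv
  · right
    rcases ρ.eq_zero_or_injective_of_commute hodd hmin (f := ρ g + 1)
      (fun k => (hg k).add_left (Commute.one_left _)) with h0 | hi
    · exact eq_neg_of_add_eq_zero_left h0
    · exact absurd (hi (by simp [h] : (ρ g + 1) v = (ρ g + 1) 0)) hv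

theorem eq_one_or_eq_neg_one_of_mem_upperCentralSeries [Finite G] (ρ : Representation ℝ G V)
    (hodd : Odd (Module.finrank ℝ V))
    (hmin : ∀ W : Submodule ℝ V, (∀ g, W ≤ W.comap (ρ g)) → Odd (Module.finrank ℝ W) → W = ⊤)
    (n : ℕ) : ∀ g ∈ Subgroup.upperCentralSeries G n, ρ g = 1 ∨ ρ g = -1 := by
  induction n with
  | zero =>
    intro g hg
    left
    rw [Subgroup.upperCentralSeries_zero, Subgroup.mem_bot] at hg
    rw [hg, map_one]
  | succ n ih =>
    intro g hg
    refine ρ.eq_one_or_eq_neg_one_of_commute hodd hmin fun h => ?_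
    rcases ih _ (Subgroup.mem_upperCentralSeries_succ_iff.1 hg h) with hc | hc
    · have : g * h = ⁅g, h⁆ * (h * g) := by simp [commutatorElement_def, mul_assoc]
      rw [commute_iff_eq, ← map_mul, this, map_mul, hc, one_mul, map_mul]
    · have hdet := ρ.det_commutatorElement g h
      have hneg : LinearMap.det (-1 : Module.End ℝ V) = -1 := by
        rw [← neg_one_smul ℝ (1 : Module.End ℝ V), LinearMap.det_smul, hodd.neg_one_pow]
        simp
      rw [hc, hneg] at hdet
      norm_num at hdet

/-- An odd-dimensional real representation of a finite nilpotent group has an invariant line,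
on which the group acts by signs. -/
theorem exists_eq_or_eq_neg_of_odd_finrank [Finite G] [Group.IsNilpotent G]
    (ρ : Representation ℝ G V) (hodd : Odd (Module.finrank ℝ V)) :
    ∃ v : V, v ≠ 0 ∧ ∀ g, ρ g v = v ∨ ρ g v = -v := by
  induction hd : Module.finrank ℝ V using Nat.strong_induction_on generalizing V with
  | _ d ih =>
    by_cases! hmin : ∀ W : Submodule ℝ V, (∀ g, W ≤ W.comap (ρ g)) →
        Odd (Module.finrank ℝ W) → W = ⊤
    · obtain ⟨n, hn⟩ := Group.IsNilpotent.nilpotent G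
      have : Nontrivial V := Module.nontrivial_of_finrank_pos (R := ℝ) hodd.pos
      obtain ⟨v, hv⟩ := exists_ne (0 : V)
      refine ⟨v, hv, fun g => ?_⟩
      rcases ρ.eq_one_or_eq_neg_one_of_mem_upperCentralSeries hodd hmin n g
        (hn ▸ Subgroup.mem_top g) with h | h <;> simp [h]
    · obtain ⟨W, hW, hWodd, hne⟩ := hmin
      obtain ⟨w, hw, h⟩ := ih _ (hd ▸ Submodule.finrank_lt hne) (ρ.subrepresentation W hW) hWodd rfl
      refine ⟨w, by simpa using hw, fun g => ?_⟩
      exact (h g).imp (congrArg Subtype.val) (congrArg Subtype.val)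

end Representation

theorem drep_dvd_index {G V : Type*} [Group G] [Fintype G] [AddCommGroup V] [SMul G V]
    {H : Subgroup G} {v : V} (hv : v ≠ 0) (h : ∀ g ∈ H, g • v = v) : drep G V ∣ H.index := by
  classical
  let : Fintype (Subgroup G) := Fintype.ofFinite _
  have hdvd := Finset.gcd_dvd (f := fun H : Subgroup G =>
    if ∃ v : V, v ≠ 0 ∧ ∀ h ∈ H, h • v = v then H.index else 0) (Finset.mem_univ H)
  rw [if_pos ⟨v, hv, h⟩] at hdvd
  unfold drep
  convert hdvd

theorem drep_dvd_two_mul_index {G V : Type*} [Group G] [Fintype G] [AddCommGroup V] [Module ℝ V]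
    [FiniteDimensional ℝ V] [DistribMulAction G V] [SMulCommClass G ℝ V]
    (hodd : Odd (Module.finrank ℝ V)) (P : Subgroup G) [Group.IsNilpotent P] :
    drep G V ∣ 2 * P.index := by
  obtain ⟨v, hv, h⟩ := Representation.exists_eq_or_eq_neg_of_odd_finrank
    ((Representation.ofDistribMulAction ℝ G V).comp P.subtype) hodd
  have horbit : (MulAction.orbit P v).ncard ≤ 2 := by
    refine (Set.ncard_le_ncard (t := {v, -v}) ?_).trans ((Set.ncard_insert_le _ _).trans (by simp))
    rintro _ ⟨g, rfl⟩
    exact h g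
  have hdvd : (MulAction.stabilizer P v).index ∣ 2 := by
    have hne : (MulAction.stabilizer P v).index ≠ 0 := Subgroup.index_ne_zero_of_finite
    rw [← MulAction.index_stabilizer] at horbit
    interval_cases (MulAction.stabilizer P v).index <;> simp_all
  refine (drep_dvd_index (H := (MulAction.stabilizer P v).map P.subtype) hv ?_).trans ?_
  · rintro _ ⟨g, hg, rfl⟩
    exact hg
  · rw [Subgroup.index_map_subtype]
    exact mul_dvd_mul_right hdvd _

theorem Nat.dvd_of_forall_prime_dvd_mul {d k : ℕ} (hk : k ≠ 0)
    (h : ∀ p, p.Prime → ∃ m, ¬ p ∣ m ∧ d ∣ k * m) : d ∣ k := by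
  have hg : 0 < Nat.gcd d k := Nat.gcd_pos_of_pos_right _ hk.bot_lt
  have hone : d / Nat.gcd d k = 1 := by
    by_contra hne
    obtain ⟨p, hp, hpd⟩ := Nat.exists_prime_and_dvd hne
    obtain ⟨m, hpm, hdm⟩ := h p hp
    refine hpm (hpd.trans ((Nat.coprime_div_gcd_div_gcd hg).dvd_of_dvd_mul_left ?_))
    rw [Nat.div_mul_right_comm (Nat.gcd_dvd_right d k)]
    exact Nat.div_dvd_div (Nat.gcd_dvd_left d k) hdm
  rw [← Nat.eq_of_dvd_of_div_eq_one (Nat.gcd_dvd_left d k) hone]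
  exact Nat.gcd_dvd_right d k

/-- If `G` is a finite group and `V` a finite-dimensional real representation of `G`
of odd dimension, then `d(V)` is either `1` or `2`. -/
theorem stmt0 (G V : Type*) [Group G] [Fintype G] [AddCommGroup V] [Module ℝ V]
    [FiniteDimensional ℝ V] [DistribMulAction G V] [SMulCommClass G ℝ V]
    (hodd : Odd (Module.finrank ℝ V)) :
    drep G V = 1 ∨ drep G V = 2 := by
  have hdvd : drep G V ∣ 2 := by
    refine Nat.dvd_of_forall_prime_dvd_mul two_ne_zero fun p hp => ?_
    have : Fact p.Prime := ⟨hp⟩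
    obtain ⟨P⟩ : Nonempty (Sylow p G) := inferInstance
    have : Group.IsNilpotent (P : Subgroup G) := P.isPGroup'.isNilpotent
    have h := drep_dvd_two_mul_index hodd (P : Subgroup G)
    exact ⟨(P : Subgroup G).index, P.not_dvd_index, h⟩
  exact (Nat.dvd_prime Nat.prime_two).1 hdvd
end

section
/- Let k ≥ 1 and let i, j, l be pairwise distinct indices in Fin k. Then the Heaviside functions satisfy the Varchenko–Gelfand (Arnold-type) relation e_{ij}·e_{jl} + e_{jl}·e_{li} + e_{li}·e_{ij} = e_{ij} + e_{jl} + e_{li} − 1 in the ring of functions Perm(Fin k) → ℤ. -/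
/- The Heaviside function `e_{ij} : Perm (Fin k) → ℤ`, with `e_{ij}(σ) = 1` if
`σ i > σ j` and `0` otherwise. Sums and products are pointwise in the
commutative ring of functions `Perm (Fin k) → ℤ`. -/
def heaviside {k : ℕ} (i j : Fin k) : Equiv.Perm (Fin k) → ℤ :=
  fun σ => if σ j < σ i then 1 else 0

/-- For `k ≥ 1` and pairwise distinct `i, j, l` in `Fin k`, the Heaviside
functions satisfy the Varchenko–Gelfand (Arnold-type) relation
`e_{ij}e_{jl} + e_{jl}e_{li} + e_{li}e_{ij} = e_{ij} + e_{jl} + e_{li} − 1`. -/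
theorem stmt8 (k : ℕ) (hk : 1 ≤ k) (i j l : Fin k)
    (hij : i ≠ j) (hjl : j ≠ l) (hil : i ≠ l) :
    heaviside i j * heaviside j l + heaviside j l * heaviside l i +
        heaviside l i * heaviside i j
      = heaviside i j + heaviside j l + heaviside l i - 1 := by
  funext σ
  have h₁ : (σ i : ℕ) ≠ σ j := fun h => hij (σ.injective (Fin.ext h))
  have h₂ : (σ j : ℕ) ≠ σ l := fun h => hjl (σ.injective (Fin.ext h))
  have h₃ : (σ i : ℕ) ≠ σ l := fun h => hil (σ.injective (Fin.ext h))
  simp only [Pi.add_apply, Pi.mul_apply, Pi.sub_apply, Pi.one_apply, heaviside, Fin.lt_def]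
  split_ifs <;> omega
end

section
/- Let k ≥ 1 and σ ∈ Perm(Fin k). Define P_σ : Perm(Fin k) → ℤ as the pointwise product over all pairs i < j in Fin k of the factor e_{ij} if σ(i) > σ(j), and of the factor 1 − e_{ij} if σ(i) < σ(j). Then P_σ equals the delta function δ_σ: for every α ∈ Perm(Fin k), P_σ(α) = 1 if α = σ and P_σ(α) = 0 otherwise. -/
/-- A permutation of `Fin k` is determined by its inversions. -/
theorem perm_eq_of_inversions_iff {k : ℕ} {α σ : Equiv.Perm (Fin k)}
    (h : ∀ i j : Fin k, i < j → (σ j < σ i ↔ α j < α i)) : α = σ := by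
  have hmono : StrictMono (fun x => α (σ.symm x)) := by
    intro x y hxy
    have hne : σ.symm x ≠ σ.symm y := fun e => hxy.ne (σ.symm.injective e)
    rcases lt_or_gt_of_ne hne with hlt | hlt
    · have hnot := (h _ _ hlt).not.mp (by simpa using hxy.le)
      exact lt_of_le_of_ne (not_lt.mp hnot) (fun e => hne (α.injective e))
    · exact (h _ _ hlt).mp (by simpa using hxy)
  have hsurj : Function.Surjective (fun x => α (σ.symm x)) :=
    α.surjective.comp σ.symm.surjective
  have hid : hmono.orderIsoOfSurjective _ hsurj = OrderIso.refl (Fin k) :=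
    Subsingleton.elim _ _
  ext i : 1
  simpa using DFunLike.congr_fun hid (σ i)

/-- The factor of `P_σ` at `(i, j)` tests whether `α` and `σ` agree on inverting `(i, j)`. -/
theorem heaviside_factor_apply {k : ℕ} (i j : Fin k) (α σ : Equiv.Perm (Fin k)) :
    (if σ j < σ i then heaviside i j else 1 - heaviside i j) α
      = if (σ j < σ i ↔ α j < α i) then 1 else 0 := by
  by_cases h₁ : σ j < σ i <;> by_cases h₂ : α j < α i <;> simp [heaviside, h₁, h₂]

/-- For `k ≥ 1` and `σ ∈ Perm (Fin k)`, the pointwise product `P_σ` over all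
pairs `i < j` in `Fin k` of the factor `e_{ij}` if `σ i > σ j` and of the factor
`1 − e_{ij}` if `σ i < σ j` equals the delta function `δ_σ`: for every
permutation `α`, `P_σ(α) = 1` if `α = σ` and `P_σ(α) = 0` otherwise. -/
theorem stmt10 (k : ℕ) (hk : 1 ≤ k) (σ : Equiv.Perm (Fin k)) :
    ∀ α : Equiv.Perm (Fin k),
      (∏ p ∈ Finset.univ.filter (fun p : Fin k × Fin k => p.1 < p.2),
          (if σ p.2 < σ p.1 then heaviside p.1 p.2 else 1 - heaviside p.1 p.2)) α
        = if α = σ then 1 else 0 := by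
  intro α
  rw [Finset.prod_apply]
  simp only [heaviside_factor_apply]
  split_ifs with h
  · subst h
    simp
  · by_contra hne
    refine h (perm_eq_of_inversions_iff fun i j hij => ?_)
    by_contra hij'
    exact hne (Finset.prod_eq_zero (i := (i, j)) (by simpa using hij) (if_neg hij'))
end

section
/- Let k ≥ 1. The ℤ-algebra homomorphism from the multivariate polynomial ring over ℤ with variables X_{(i,j)} indexed by ordered pairs (i,j) of distinct elements of Fin k, to the ring of functions Perm(Fin k) → ℤ (with pointwise operations), determined by sending X_{(i,j)} to the Heaviside function e_{ij}, is surjective. -/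
/-- A permutation of `Fin k` that preserves every strict inequality satisfied by another
permutation is equal to it. -/
lemma perm_eq_of_forall_lt_imp_lt {k : ℕ} {σ τ : Equiv.Perm (Fin k)}
    (h : ∀ i j, τ j < τ i → σ j < σ i) : σ = τ := by
  have hmono : StrictMono (σ ∘ τ.symm) := fun a b hab => h _ _ (by simpa using hab)
  have heq : σ ∘ τ.symm = id := (hmono.range_inj strictMono_id).mp (by
    rw [(σ.surjective.comp τ.symm.surjective).range_eq, Set.range_id])
  ext i
  simpa using congrArg Fin.val (congrFun heq (τ i))

/-- The indicator of a permutation `τ` is the product of the Heaviside functions equal to `1`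
at `τ`. -/
lemma prod_heaviside_eq_single {k : ℕ} (τ : Equiv.Perm (Fin k)) :
    ∏ p : {p : Fin k × Fin k // p.1 ≠ p.2} with τ p.1.2 < τ p.1.1,
      heaviside p.1.1 p.1.2 = Pi.single τ (1 : ℤ) := by
  funext σ
  rw [Finset.prod_apply]
  by_cases hσ : σ = τ
  · subst hσ
    rw [Pi.single_eq_same]
    exact Finset.prod_eq_one fun p hp => if_pos (Finset.mem_filter.mp hp).2
  · rw [Pi.single_eq_of_ne hσ]
    obtain ⟨i, j, hτ, hn⟩ : ∃ i j, τ j < τ i ∧ ¬ σ j < σ i := by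
      by_contra! hcon
      exact hσ (perm_eq_of_forall_lt_imp_lt hcon)
    have hij : i ≠ j := fun hij => hτ.ne (by rw [hij])
    exact Finset.prod_eq_zero (i := ⟨(i, j), hij⟩) (by simpa using hτ) (if_neg hn)

/-- For `k ≥ 1`, the `ℤ`-algebra homomorphism from the multivariate polynomial
ring over `ℤ` with variables indexed by ordered pairs of distinct elements of
`Fin k` to the ring of functions `Perm (Fin k) → ℤ`, sending the variable
`X_{(i,j)}` to the Heaviside function `e_{ij}`, is surjective. -/
theorem stmt11 (k : ℕ) (hk : 1 ≤ k) :
    Function.Surjective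
      (MvPolynomial.aeval
          (fun p : {p : Fin k × Fin k // p.1 ≠ p.2} => heaviside p.1.1 p.1.2) :
        MvPolynomial {p : Fin k × Fin k // p.1 ≠ p.2} ℤ →ₐ[ℤ]
          (Equiv.Perm (Fin k) → ℤ)) := by
  intro f
  refine ⟨∑ τ, f τ • ∏ p : {p : Fin k × Fin k // p.1 ≠ p.2} with τ p.1.2 < τ p.1.1,
    MvPolynomial.X p, ?_⟩
  simp only [map_sum, map_smul, map_prod, MvPolynomial.aeval_X, prod_heaviside_eq_single]
  exact (pi_eq_sum_univ' f).symm
end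

section
/- Let k ≥ 1 and let x, y : Fin k → ℝ be injective. Then x and y are joined by a path inside the ordered configuration space OC_k(ℝ) = { z : Fin k → ℝ | z injective } (i.e. JoinedIn holds for this subset) if and only if for all i, j ∈ Fin k, x(i) < x(j) ⟺ y(i) < y(j). -/
/-- A path of injective functions preserves strict inequalities between coordinates. -/
theorem JoinedIn.lt_of_lt_of_injective {ι : Type*} {x y : ι → ℝ}
    (h : JoinedIn {z : ι → ℝ | Function.Injective z} x y) {i j : ι} (hij : x i < x j) :
    y i < y j := by
  obtain ⟨γ, hγ⟩ := h
  by_contra! hle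
  have hcont : Continuous fun t : unitInterval => γ t j - γ t i :=
    ((continuous_apply j).comp γ.continuous).sub ((continuous_apply i).comp γ.continuous)
  obtain ⟨t, ht⟩ := intermediate_value_univ 1 0 hcont
    (show (0 : ℝ) ∈ Set.Icc _ _ by
      simp only [γ.source, γ.target]
      exact ⟨sub_nonpos.2 hle, (sub_pos.2 hij).le⟩)
  have hji : j = i := hγ t (sub_eq_zero.1 ht)
  exact hij.ne (congrArg x hji.symm)

/-- The segment between two injective functions inducing the same order on the index type
consists of injective functions. -/
theorem segment_subset_setOf_injective {ι : Type*} {x y : ι → ℝ} (hx : Function.Injective x)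
    (h : ∀ i j, x i < x j ↔ y i < y j) :
    segment ℝ x y ⊆ {z : ι → ℝ | Function.Injective z} := by
  rintro z ⟨a, b, ha, hb, hab, rfl⟩
  have key : ∀ i j, x i < x j → (a • x + b • y) i < (a • x + b • y) j := by
    intro i j hij
    have hij' := (h i j).1 hij
    simp only [Pi.add_apply, Pi.smul_apply, smul_eq_mul]
    rcases ha.eq_or_lt with rfl | ha
    · obtain rfl : b = 1 := by linarith
      linarith
    · exact add_lt_add_of_lt_of_le (mul_lt_mul_of_pos_left hij ha)
        (mul_le_mul_of_nonneg_left hij'.le hb)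
  intro i j hz
  by_contra hne
  rcases lt_or_gt_of_ne (hx.ne hne) with hlt | hlt
  · exact (key i j hlt).ne hz
  · exact (key j i hlt).ne hz.symm

/-- Let `k ≥ 1` and let `x, y : Fin k → ℝ` be injective. Then `x` and `y` are
joined by a path inside the ordered configuration space
`OC_k(ℝ) = {z : Fin k → ℝ | z injective}` if and only if for all `i, j`,
`x i < x j ↔ y i < y j`. -/
theorem stmt13 (k : ℕ) (hk : 1 ≤ k) (x y : Fin k → ℝ)
    (hx : Function.Injective x) (hy : Function.Injective y) :
    JoinedIn {z : Fin k → ℝ | Function.Injective z} x y ↔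
      ∀ i j : Fin k, x i < x j ↔ y i < y j := by
  exact ⟨fun h _ _ => ⟨h.lt_of_lt_of_injective, h.symm.lt_of_lt_of_injective⟩,
    fun h => JoinedIn.of_segment_subset (segment_subset_setOf_injective hx h)⟩
end

section
/- Let k ≥ 1. The map sending a locally constant function f : OC_k(ℝ) → ℤ to the function Perm(Fin k) → ℤ given by σ ↦ f(x_σ), where x_σ : Fin k → ℝ is the injective tuple x_σ(i) = σ(i) (the value of σ(i) ∈ Fin k viewed as a real number), is an isomorphism of commutative rings from the ring of locally constant ℤ-valued functions on OC_k(ℝ) onto the ring of all functions Perm(Fin k) → ℤ with pointwise operations. -/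
/- The ring homomorphism sending a locally constant function
`f : OC_k(ℝ) → ℤ` to the function `Perm (Fin k) → ℤ` given by
`σ ↦ f (x_σ)`, where `x_σ (i) = σ i` (viewed as a real number). -/
noncomputable def evalAtPerm (k : ℕ) :
    LocallyConstant {x : Fin k → ℝ // Function.Injective x} ℤ →+*
      (Equiv.Perm (Fin k) → ℤ) where
  toFun f := fun σ => f ⟨fun i => ((σ i : ℕ) : ℝ), by
    intro a b hab
    exact σ.injective (Fin.val_injective (Nat.cast_injective hab))⟩
  map_one' := rfl
  map_mul' _ _ := rfl
  map_zero' := rfl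
  map_add' _ _ := rfl

/-- The permutation sending each index to the rank of the corresponding coordinate of `x`. -/
noncomputable def rankPerm {k : ℕ} (x : Fin k → ℝ) : Equiv.Perm (Fin k) :=
  (Tuple.sort x).symm

theorem rankPerm_lt_iff {k : ℕ} {x : Fin k → ℝ} (hx : Function.Injective x) (i j : Fin k) :
    rankPerm x i < rankPerm x j ↔ x i < x j := by
  have hmono : StrictMono (x ∘ Tuple.sort x) :=
    (Tuple.monotone_sort x).strictMono_of_injective (hx.comp (Tuple.sort x).injective)
  simpa [rankPerm] using
    (hmono.lt_iff_lt (a := (Tuple.sort x).symm i) (b := (Tuple.sort x).symm j)).symm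

theorem perm_eq_of_lt_imp_lt {k : ℕ} {σ τ : Equiv.Perm (Fin k)}
    (h : ∀ i j, σ i < σ j → τ i < τ j) : τ = σ := by
  have hmono : StrictMono (τ ∘ σ.symm) := fun a b hab => h _ _ (by simpa using hab)
  have hid : τ ∘ σ.symm = id := (hmono.range_inj strictMono_id).1 (by
    rw [(τ.surjective.comp σ.symm.surjective).range_eq, Set.range_id])
  ext i
  simpa using congrArg Fin.val (congrFun hid (σ i))

theorem rankPerm_eq_of_lt_imp_lt {k : ℕ} {x : Fin k → ℝ} (hx : Function.Injective x)
    {σ : Equiv.Perm (Fin k)} (h : ∀ i j, σ i < σ j → x i < x j) : rankPerm x = σ :=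
  perm_eq_of_lt_imp_lt fun i j hij => (rankPerm_lt_iff hx i j).2 (h i j hij)

theorem isLocallyConstant_rankPerm (k : ℕ) :
    IsLocallyConstant fun x : {x : Fin k → ℝ // Function.Injective x} => rankPerm x.1 := by
  rw [IsLocallyConstant.iff_eventually_eq]
  intro x
  have hnear : ∀ᶠ y : {x : Fin k → ℝ // Function.Injective x} in nhds x,
      ∀ i j, x.1 i < x.1 j → y.1 i < y.1 j := by
    simp only [Filter.eventually_all]
    intro i j hij
    have hcont (l : Fin k) :
        Continuous fun y : {x : Fin k → ℝ // Function.Injective x} => y.1 l :=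
      (continuous_apply l).comp continuous_subtype_val
    exact (hcont i).continuousAt.eventually_lt (hcont j).continuousAt hij
  filter_upwards [hnear] with y hy
  exact rankPerm_eq_of_lt_imp_lt y.2 fun i j hij => hy i j ((rankPerm_lt_iff x.2 i j).1 hij)

theorem injective_lineMap_of_lt_imp_lt {k : ℕ} {x y : Fin k → ℝ} (hx : Function.Injective x)
    (h : ∀ i j, x i < x j → y i < y j) (t : unitInterval) :
    Function.Injective fun i => (1 - (t : ℝ)) * x i + t * y i := by
  have hlt : ∀ i j, x i < x j →
      (1 - (t : ℝ)) * x i + t * y i < (1 - (t : ℝ)) * x j + t * y j := by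
    intro i j hij
    have hy := h i j hij
    rcases t.2.1.eq_or_lt with ht | ht
    · simpa [← ht] using hij
    · exact add_lt_add_of_le_of_lt
        (mul_le_mul_of_nonneg_left hij.le (sub_nonneg.2 t.2.2)) (mul_lt_mul_of_pos_left hy ht)
  intro i j hij
  by_contra hne
  rcases lt_or_gt_of_ne (hx.ne hne) with hl | hl
  · exact (hlt i j hl).ne hij
  · exact (hlt j i hl).ne hij.symm

theorem LocallyConstant.apply_eq_of_lt_imp_lt {k : ℕ} {Y : Type*}
    (f : LocallyConstant {x : Fin k → ℝ // Function.Injective x} Y)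
    (x y : {x : Fin k → ℝ // Function.Injective x})
    (h : ∀ i j, x.1 i < x.1 j → y.1 i < y.1 j) : f x = f y := by
  let γ : C(unitInterval, {x : Fin k → ℝ // Function.Injective x}) :=
    ⟨fun t => ⟨fun i => (1 - (t : ℝ)) * x.1 i + t * y.1 i,
      injective_lineMap_of_lt_imp_lt x.2 h t⟩, by fun_prop⟩
  have h0 : γ 0 = x := by ext i; simp [γ]
  have h1 : γ 1 = y := by ext i; simp [γ]
  rw [← h0, ← h1]
  exact (f.comap γ).apply_eq_of_preconnectedSpace 0 1

/-- For `k ≥ 1`, the map `f ↦ (σ ↦ f (x_σ))` is an isomorphism of commutative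
rings from the ring of locally constant `ℤ`-valued functions on the ordered
configuration space `OC_k(ℝ)` onto the ring of all functions
`Perm (Fin k) → ℤ` with pointwise operations. -/
theorem stmt14 (k : ℕ) (hk : 1 ≤ k) :
    Function.Bijective (evalAtPerm k) := by
  constructor
  · intro f g hfg
    ext x
    have hval (i j : Fin k) (hij : x.1 i < x.1 j) :
        ((rankPerm x.1 i : ℕ) : ℝ) < ((rankPerm x.1 j : ℕ) : ℝ) :=
      Nat.cast_lt.2 ((rankPerm_lt_iff x.2 i j).2 hij)
    have hinj : Function.Injective fun i => ((rankPerm x.1 i : ℕ) : ℝ) :=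
      fun a b hab => (rankPerm x.1).injective (Fin.val_injective (Nat.cast_injective hab))
    rw [f.apply_eq_of_lt_imp_lt x ⟨_, hinj⟩ hval, g.apply_eq_of_lt_imp_lt x ⟨_, hinj⟩ hval]
    exact congrFun hfg (rankPerm x.1)
  · intro g
    refine ⟨⟨fun x => g (rankPerm x.1), (isLocallyConstant_rankPerm k).comp g⟩, ?_⟩
    funext σ
    exact congrArg g (rankPerm_eq_of_lt_imp_lt
      (fun a b hab => σ.injective (Fin.val_injective (Nat.cast_injective hab)))
      fun i j hij => Nat.cast_lt.2 hij)
end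

section
/- For all integers k ≥ 1 and 0 ≤ j ≤ k−1, the alternating sum a(k,j) = Σ_{i=0}^{j} (−1)^i · c(k, k−(j−i)) of unsigned Stirling numbers of the first kind is nonnegative (as an integer). (These a(k,j) arise as the multiplicities of the wedge summands in the splitting of the configuration-space motive in Theorem 4.8.) -/
open Polynomial in
theorem X_add_one_dvd_ascPochhammer (n : ℕ) : (X + 1 : ℕ[X]) ∣ ascPochhammer ℕ (n + 2) := by
  induction n with
  | zero => exact ⟨X, by simp [ascPochhammer_succ_right, mul_comm]⟩
  | succ n ih =>
    rw [ascPochhammer_succ_right]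
    exact ih.mul_right _

/-- Alternating sums of consecutive sums telescope. -/
theorem sum_range_neg_one_pow_mul_add_succ (r : ℕ → ℤ) (n : ℕ) :
    ∑ i ∈ Finset.range n, (-1 : ℤ) ^ i * (r i + r (i + 1)) = r 0 - (-1) ^ n * r n := by
  induction n with
  | zero => simp
  | succ n ih => rw [Finset.sum_range_succ, ih]; ring


/-- For integers `k ≥ 1` and `0 ≤ j ≤ k − 1`, the alternating sum
`a(k,j) = Σ_{i=0}^{j} (−1)^i ⬝ c(k, k−(j−i))` of unsigned Stirling numbers of
the first kind (`c(k,m) = (ascPochhammer ℕ k).coeff m`) is nonnegative. -/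
theorem stmt17 (k j : ℕ) (hk : 1 ≤ k) (hj : j ≤ k - 1) :
    0 ≤ ∑ i ∈ Finset.range (j + 1),
        (-1 : ℤ) ^ i * ((ascPochhammer ℕ k).coeff (k - (j - i)) : ℤ) := by
  obtain rfl | ⟨n, rfl⟩ : k = 1 ∨ ∃ n, k = n + 2 := by
    rcases k with _ | _ | n
    · omega
    · exact Or.inl rfl
    · exact Or.inr ⟨n, rfl⟩
  · obtain rfl : j = 0 := by omega
    simp
  · obtain ⟨R, hR⟩ := X_add_one_dvd_ascPochhammer n
    have hcoeff (m : ℕ) : (ascPochhammer ℕ (n + 2)).coeff (m + 1) =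
        R.coeff m + R.coeff (m + 1) := by
      rw [hR, add_mul, one_mul, Polynomial.coeff_add, Polynomial.coeff_X_mul]
    have hzero : R.coeff (n + 2) = 0 := by
      have h := hcoeff (n + 2)
      rw [Polynomial.coeff_eq_zero_of_natDegree_lt (by simp [ascPochhammer_natDegree])] at h
      omega
    have hsum : ∑ i ∈ Finset.range (j + 1),
        (-1 : ℤ) ^ i * ((ascPochhammer ℕ (n + 2)).coeff (n + 2 - (j - i)) : ℤ) =
        ∑ i ∈ Finset.range (j + 1), (-1 : ℤ) ^ i *
          ((R.coeff (n + 1 - j + i) : ℤ) + (R.coeff (n + 1 - j + (i + 1)) : ℤ)) := by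
      refine Finset.sum_congr rfl fun i hi => ?_
      have hi' := Finset.mem_range.mp hi
      rw [show n + 2 - (j - i) = n + 1 - j + i + 1 by omega, hcoeff]
      push_cast
      rfl
    rw [hsum, sum_range_neg_one_pow_mul_add_succ fun i => (R.coeff (n + 1 - j + i) : ℤ),
      show n + 1 - j + (j + 1) = n + 2 by omega, hzero]
    simp
end
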